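/- Let (W,S) be a finite Coxeter system. For every integer k ≥ 1 and every subset J ⊆ S, the number of k-chains u₁ ≤_β … ≤_β u_k in the BHZ order on W whose top element has support equal to J equals Σ_{K ⊆ J} (−1)^{#J − #K} · (the number of k-chains in the BHZ order on W all of whose elements lie in the parabolic subgroup W_K). -/

import Mathlib

open scoped Classical

namespace ShardBHZ

variable {B : Type*} {W : Type*} [Group W] {M : CoxeterMatrix B} (cs : CoxeterSystem M W)

/-- The support `S(w)` of `w`: the set of simple reflections appearing in some
(equivalently, any) reduced word for `w`. -/
def supp (w : W) : Set B := {i | ∃ l : List B, cs.IsReduced l ∧ cs.wordProd l = w ∧ i ∈ l}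

/-- The standard parabolic subgroup `W_I` generated by the simple reflections in `I`. -/
def parab (I : Set B) : Subgroup W := Subgroup.closure (cs.simple '' I)

/-- `x` has no right descent in `I`; this characterizes the minimal length coset
representatives `W^I` of `W / W_I`. -/
def IsMinRep (I : Set B) (x : W) : Prop := ∀ i ∈ I, ¬ cs.IsRightDescent x i

/-- The BHZ order: `u ≤_β v` iff the parabolic component `v_{S(u)}` equals `u`, i.e.
`v = (v * u⁻¹) * u` is the parabolic factorization of `v` with respect to `W_{S(u)}`:
`u ∈ W_{S(u)}`, `v * u⁻¹` has no right descent in `S(u)`, and lengths add. -/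
def bhzLE (u v : W) : Prop :=
  u ∈ parab cs (supp cs u) ∧ IsMinRep cs (supp cs u) (v * u⁻¹) ∧
    cs.length v = cs.length (v * u⁻¹) + cs.length u

/-- The set `N(w)` of left inversions of `w`. -/
def invSet (w : W) : Set W := {t | cs.IsLeftInversion w t}

/-- The subgroup `G(w)` generated by `w * s * w⁻¹` for `s` a right descent of `w`. -/
def descConj (w : W) : Subgroup W :=
  Subgroup.closure {x | ∃ i, cs.IsRightDescent w i ∧ x = w * cs.simple i * w⁻¹}

/-- The shard intersection order: `u ≤_σ v` iff `N(u) ⊆ N(v)` and `G(u) ⊆ G(v)`. -/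
def shardLE (u v : W) : Prop := invSet cs u ⊆ invSet cs v ∧ descConj cs u ≤ descConj cs v

/-- The number of `(k+1)`-chains for the relation `r` whose top element has
support `J`. -/
noncomputable def nchainsTop (r : W → W → Prop) (k : ℕ) (J : Set B) : ℕ :=
  Nat.card {c : Fin (k + 1) → W //
    (∀ i j : Fin (k + 1), i ≤ j → r (c i) (c j)) ∧ supp cs (c (Fin.last k)) = J}

/-- The number of `(k+1)`-chains for the relation `r` all of whose elements lie in
the parabolic subgroup `W_K`. -/
noncomputable def nchainsIn (r : W → W → Prop) (k : ℕ) (K : Set B) : ℕ :=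
  Nat.card {c : Fin (k + 1) → W //
    (∀ i j : Fin (k + 1), i ≤ j → r (c i) (c j)) ∧ ∀ i : Fin (k + 1), c i ∈ parab cs K}

section GeometricRepresentation

open Module Polynomial.Chebyshev

/-- Two reflections `r`, `r'` whose pairings are those of two unit normals at angle `π - π / m`
satisfy `(r * r') ^ m = 1`. -/
theorem reflection_mul_reflection_pow_eq_one {V : Type*} [AddCommGroup V] [Module ℝ V]
    {x y : V} {f g : Dual ℝ V} (hf : f x = 2) (hg : g y = 2) {m : ℕ} (hm : 2 ≤ m)
    (hfy : f y = -2 * Real.cos (Real.pi / m)) (hgx : g x = -2 * Real.cos (Real.pi / m)) :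
    (reflection hf * reflection hg) ^ m = 1 := by
  rcases hm.eq_or_lt with rfl | hm
  · have hfy0 : f y = 0 := by simp [hfy]
    have hgx0 : g x = 0 := by simp [hgx]
    ext z
    simp only [pow_two, LinearEquiv.mul_apply, reflection_apply, map_sub, map_smul, hf, hg, hfy0,
      hgx0, LinearEquiv.coe_one, id_eq]
    module
  have hm0 : (0 : ℝ) < m := by exact_mod_cast (by omega : 0 < m)
  set θ : ℝ := 2 * (Real.pi / m) with hθ
  have hmθ : (m : ℝ) * θ = 2 * Real.pi := by rw [hθ]; field_simp
  have ht : 2 * Real.cos θ = f y * g x - 2 := by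
    rw [hfy, hgx, hθ, Real.cos_two_mul]; ring
  have hsin : Real.sin θ ≠ 0 := by
    apply ne_of_gt
    apply Real.sin_pos_of_pos_of_lt_pi
    · positivity
    · have h3 : (3 : ℝ) ≤ m := by exact_mod_cast hm
      rw [hθ, ← mul_div_assoc, div_lt_iff₀ hm0]
      nlinarith [Real.pi_pos]
  have hS (n : ℤ) := S_two_mul_real_cos θ n
  ext z
  rw [reflection_mul_reflection_pow_apply hf hg m z _ ht]
  obtain ⟨k, rfl | rfl⟩ := m.even_or_odd'
  · have hk : (S ℝ ((k : ℤ) - 1)).eval (2 * Real.cos θ) = 0 := by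
      refine (mul_eq_zero.mp ?_).resolve_right hsin
      rw [hS]
      push_cast at hmθ ⊢
      rw [show ((k : ℝ) - 1 + 1) * θ = Real.pi by linarith, Real.sin_pi]
    rw [show (((2 * k : ℕ) : ℤ) - 2) / 2 = k - 1 by omega,
      show (((2 * k : ℕ) : ℤ) - 1) / 2 = k - 1 by omega, hk]
    simp
  · have hk : (S ℝ (k : ℤ)).eval (2 * Real.cos θ) +
        (S ℝ ((k : ℤ) - 1)).eval (2 * Real.cos θ) = 0 := by
      refine (mul_eq_zero.mp ?_).resolve_right hsin
      rw [add_mul, hS, hS]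
      push_cast at hmθ ⊢
      rw [show ((k : ℝ) + 1) * θ = 2 * Real.pi - ((k : ℝ) - 1 + 1) * θ by linarith,
        Real.sin_two_pi_sub]
      ring
    rw [show (((2 * k + 1 : ℕ) : ℤ) - 2) / 2 = k - 1 by omega,
      show (((2 * k + 1 : ℕ) : ℤ) - 1) / 2 = k by omega,
      show (((2 * k + 1 : ℕ) : ℤ) - 3) / 2 = k - 1 by omega,
      show (((2 * k + 1 : ℕ) : ℤ)) / 2 = k by omega, hk]
    simp

/-- The simple coroot of `i`, as a functional on the space with basis the simple roots. -/
noncomputable def coroot (M : CoxeterMatrix B) (i : B) : Dual ℝ (B →₀ ℝ) :=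
  Finsupp.linearCombination ℝ fun j ↦ -2 * Real.cos (Real.pi / M i j)

theorem coroot_single (i j : B) :
    coroot M i (Finsupp.single j 1) = -2 * Real.cos (Real.pi / M i j) := by
  simp [coroot]

theorem coroot_single_self (i : B) : coroot M i (Finsupp.single i 1) = 2 := by
  simp [coroot_single]

theorem isLiftable_reflection :
    M.IsLiftable fun i ↦ reflection (coroot_single_self (M := M) i) := by
  intro i j
  by_cases hij : i = j
  · subst hij
    ext1 z
    simp only [CoxeterMatrix.diagonal, pow_one, LinearEquiv.mul_apply]
    exact involutive_reflection (coroot_single_self i) z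
  rcases Nat.eq_zero_or_pos (M i j) with h0 | hpos
  · simp [h0]
  · have h1 := M.off_diagonal i j hij
    refine reflection_mul_reflection_pow_eq_one _ _ (by change M i j ≠ 1 at h1; omega)
      (coroot_single i j) ?_
    rw [coroot_single, M.symmetric]

/-- A simple reflection lying in the parabolic subgroup `W_K` is indexed by an element of `K`. -/
theorem mem_of_simple_mem_parab {K : Set B} {i : B} (h : cs.simple i ∈ parab cs K) : i ∈ K := by
  let ρ : W →* ((B →₀ ℝ) ≃ₗ[ℝ] (B →₀ ℝ)) := cs.lift ⟨_, isLiftable_reflection⟩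
  have hρ (j : B) (v : B →₀ ℝ) :
      ρ (cs.simple j) v = v - coroot M j v • Finsupp.single j 1 := by
    rw [show ρ (cs.simple j) = _ from cs.lift_apply_simple isLiftable_reflection j,
      reflection_apply]
  by_contra hi
  have key : ∀ w ∈ parab cs K, ∀ v : B →₀ ℝ, ρ w v i = v i := by
    intro w hw
    induction hw using Subgroup.closure_induction with
    | mem x hx =>
      obtain ⟨j, hj, rfl⟩ := hx
      intro v
      have hji : j ≠ i := fun h ↦ hi (h ▸ hj)
      simp [hρ, hji]
    | one => simp
    | mul x y _ _ hx hy =>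
      intro v
      rw [map_mul, LinearEquiv.mul_apply, hx, hy]
    | inv x _ hx =>
      intro v
      rw [← hx (ρ x⁻¹ v), ← LinearEquiv.mul_apply, ← map_mul]
      simp
  have := key _ h (Finsupp.single i 1)
  rw [hρ, coroot_single_self] at this
  norm_num at this

end GeometricRepresentation

section InversionParity

/-- The generators of the action of `W` on `W × ZMod 2` recording parities of right inversion
sequences. -/
noncomputable def parityStep (i : B) : Function.End (W × ZMod 2) := fun p ↦
  (cs.simple i * p.1 * cs.simple i, p.2 + if p.1 = cs.simple i then 1 else 0)

theorem parityStep_apply (i : B) (t : W) (ε : ZMod 2) :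
    parityStep cs i (t, ε) =
      (cs.simple i * t * cs.simple i, ε + if t = cs.simple i then 1 else 0) :=
  rfl

theorem end_mul_apply {α : Type*} (f g : Function.End α) (a : α) : (f * g) a = f (g a) :=
  rfl

theorem parityStep_mul_pow (i j : B) (n : ℕ) (t : W) (ε : ZMod 2) :
    ((parityStep cs i * parityStep cs j) ^ n) (t, ε) =
      ((cs.simple i * cs.simple j) ^ n * t * ((cs.simple i * cs.simple j) ^ n)⁻¹,
        ε + ∑ k ∈ Finset.range (2 * n),
          if t = cs.simple j * (cs.simple i * cs.simple j) ^ k then 1 else 0) := by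
  induction n with
  | zero => simp [Function.End.one_def]
  | succ n ih =>
    set r := cs.simple i * cs.simple j with hr
    have hconj : cs.simple j * r ^ n = (r ^ n)⁻¹ * cs.simple j := by
      have h1 : SemiconjBy (cs.simple j) r r⁻¹ := by
        simp [SemiconjBy, hr, mul_assoc]
      simpa [SemiconjBy] using h1.pow_right n
    have hj : r ^ n * t * (r ^ n)⁻¹ = cs.simple j ↔ t = cs.simple j * r ^ (2 * n) := by
      rw [two_mul, pow_add, ← mul_assoc, hconj, mul_inv_eq_iff_eq_mul, ← eq_inv_mul_iff_mul_eq,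
        mul_assoc]
    have hi : cs.simple j * (r ^ n * t * (r ^ n)⁻¹) * cs.simple j = cs.simple i ↔
        t = cs.simple j * r ^ (2 * n + 1) := by
      have : cs.simple j * (r ^ n * t * (r ^ n)⁻¹) * cs.simple j = cs.simple i ↔
          r ^ n * t * (r ^ n)⁻¹ = cs.simple j * (cs.simple i * cs.simple j) := by
        constructor
        · intro h
          rw [← mul_assoc, ← h]
          simp [mul_assoc]
        · intro h
          rw [h]
          simp [mul_assoc]
      rw [this, ← hr, mul_inv_eq_iff_eq_mul, ← eq_inv_mul_iff_mul_eq, mul_assoc, ← pow_succ',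
        ← mul_assoc, ← hconj, mul_assoc, ← pow_add]
      rw [show n + (n + 1) = 2 * n + 1 by ring]
    rw [pow_succ', end_mul_apply, ih, end_mul_apply]
    simp only [parityStep_apply, hj, hi, Prod.mk.injEq]
    constructor
    · simp [pow_succ', hr, mul_assoc]
    · rw [show 2 * (n + 1) = 2 * n + 1 + 1 by ring, Finset.sum_range_succ,
        Finset.sum_range_succ]
      ring

theorem isLiftable_parityStep : M.IsLiftable (parityStep cs) := by
  intro i j
  funext ⟨t, ε⟩
  rw [parityStep_mul_pow, two_mul, Finset.sum_range_add]
  simp [pow_add, CharTwo.add_self_eq_zero, Function.End.one_def]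

theorem lift_parityStep_wordProd (l : List B) (t : W) (ε : ZMod 2) :
    cs.lift ⟨_, isLiftable_parityStep cs⟩ (cs.wordProd l) (t, ε) =
      (cs.wordProd l * t * (cs.wordProd l)⁻¹, ε + ((cs.rightInvSeq l).count t : ZMod 2)) := by
  induction l with
  | nil => simp [Function.End.one_def]
  | cons i l ih =>
    rw [cs.wordProd_cons, map_mul, end_mul_apply, ih, cs.lift_apply_simple]
    have h : cs.wordProd l * t * (cs.wordProd l)⁻¹ = cs.simple i ↔
        (cs.wordProd l)⁻¹ * cs.simple i * cs.wordProd l = t := by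
      rw [mul_inv_eq_iff_eq_mul, ← eq_inv_mul_iff_mul_eq, eq_comm, mul_assoc]
    simp only [parityStep_apply, h, CoxeterSystem.rightInvSeq, List.count_cons, beq_iff_eq,
      Prod.mk.injEq]
    constructor
    · simp [mul_assoc]
    · push_cast
      ring

/-- The parity of the multiplicity of `t` in the right inversion sequence of a word depends only
on the product of the word. -/
theorem count_rightInvSeq_cast_eq {l l' : List B} (h : cs.wordProd l = cs.wordProd l') (t : W) :
    ((cs.rightInvSeq l).count t : ZMod 2) = (cs.rightInvSeq l').count t := by
  have h1 := lift_parityStep_wordProd cs l t 0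
  rw [h, lift_parityStep_wordProd] at h1
  simpa using (congrArg Prod.snd h1).symm

end InversionParity

section Parabolic

variable {cs} {K : Set B}

theorem simple_mem_parab {i : B} (hi : i ∈ K) : cs.simple i ∈ parab cs K :=
  Subgroup.subset_closure ⟨i, hi, rfl⟩

theorem wordProd_mem_parab {l : List B} (hl : ∀ i ∈ l, i ∈ K) : cs.wordProd l ∈ parab cs K := by
  induction l with
  | nil => simp [one_mem]
  | cons i l ih =>
    rw [cs.wordProd_cons]
    rw [List.forall_mem_cons] at hl
    exact mul_mem (simple_mem_parab hl.1) (ih hl.2)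

theorem exists_word_of_mem_parab {w : W} (hw : w ∈ parab cs K) :
    ∃ l : List B, (∀ i ∈ l, i ∈ K) ∧ cs.wordProd l = w := by
  induction hw using Subgroup.closure_induction with
  | mem x hx =>
    obtain ⟨i, hi, rfl⟩ := hx
    exact ⟨[i], by simpa using hi, by simp⟩
  | one => exact ⟨[], by simp, by simp⟩
  | mul x y _ _ hx hy =>
    obtain ⟨l, hl, rfl⟩ := hx
    obtain ⟨l', hl', rfl⟩ := hy
    refine ⟨l ++ l', fun i hi ↦ ?_, cs.wordProd_append l l'⟩
    exact (List.mem_append.mp hi).elim (hl i) (hl' i)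
  | inv x _ hx =>
    obtain ⟨l, hl, rfl⟩ := hx
    exact ⟨l.reverse, by simpa using hl, cs.wordProd_reverse l⟩

theorem mem_parab_of_mem_rightInvSeq {l : List B} (hl : ∀ i ∈ l, i ∈ K) {t : W}
    (ht : t ∈ cs.rightInvSeq l) : t ∈ parab cs K := by
  induction l with
  | nil => simp at ht
  | cons i l ih =>
    rw [List.forall_mem_cons] at hl
    rcases List.mem_cons.mp ht with rfl | ht
    · have hw := wordProd_mem_parab (cs := cs) hl.2
      exact mul_mem (mul_mem (inv_mem hw) (simple_mem_parab hl.1)) hw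
    · exact ih hl.2 ht

theorem mem_of_rightInvSeq_mem_parab {l : List B}
    (h : ∀ t ∈ cs.rightInvSeq l, t ∈ parab cs K) : ∀ i ∈ l, i ∈ K := by
  induction l with
  | nil => simp
  | cons i l ih =>
    rw [CoxeterSystem.rightInvSeq, List.forall_mem_cons] at h
    have hl := ih h.2
    have hw := wordProd_mem_parab (cs := cs) hl
    rw [List.forall_mem_cons]
    refine ⟨mem_of_simple_mem_parab cs ?_, hl⟩
    rw [mul_assoc, Subgroup.mul_mem_cancel_left _ (inv_mem hw),
      Subgroup.mul_mem_cancel_right _ hw] at h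
    exact h.1

/-- An element lies in the parabolic subgroup `W_K` iff its support is contained in `K`. -/
theorem mem_parab_iff_supp_subset {w : W} : w ∈ parab cs K ↔ supp cs w ⊆ K := by
  constructor
  · rintro hw i ⟨l, hred, hprod, hi⟩
    obtain ⟨l', hl', rfl⟩ := exists_word_of_mem_parab hw
    refine mem_of_rightInvSeq_mem_parab (cs := cs) (fun t ht ↦ ?_) i hi
    refine mem_parab_of_mem_rightInvSeq hl' ?_
    have hcount := count_rightInvSeq_cast_eq cs hprod t
    rw [List.count_eq_one_of_mem hred.nodup_rightInvSeq ht] at hcount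
    by_contra hn
    rw [List.count_eq_zero_of_not_mem hn] at hcount
    simp at hcount
  · intro h
    obtain ⟨l, hred, rfl⟩ := cs.exists_isReduced w
    exact wordProd_mem_parab fun i hi ↦ h ⟨l, hred, rfl, hi⟩

theorem supp_subset_of_bhzLE {u v : W} (h : bhzLE cs u v) : supp cs u ⊆ supp cs v := by
  rintro i ⟨l, hred, rfl, hi⟩
  obtain ⟨l', hred', hl'⟩ := cs.exists_isReduced (v * (cs.wordProd l)⁻¹)
  have hv : cs.wordProd (l' ++ l) = v := by
    rw [cs.wordProd_append, ← hl', inv_mul_cancel_right]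
  refine ⟨l' ++ l, ?_, hv, List.mem_append_right _ hi⟩
  have hlen := h.2.2
  rw [hl', hred.eq, hred'.eq] at hlen
  rw [CoxeterSystem.IsReduced, hv, hlen, List.length_append]

end Parabolic

/-- The number of chains lying in `W_K` counts the chains whose top has support inside `K`. -/
theorem nchainsIn_bhzLE_eq (k : ℕ) (K : Set B) :
    nchainsIn cs (bhzLE cs) k K = Nat.card {c : Fin (k + 1) → W //
      (∀ i j : Fin (k + 1), i ≤ j → bhzLE cs (c i) (c j)) ∧ supp cs (c (Fin.last k)) ⊆ K} := by
  refine Nat.card_congr (Equiv.subtypeEquivRight fun c ↦ and_congr_right fun hc ↦ ?_)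
  simp only [mem_parab_iff_supp_subset]
  exact ⟨fun h ↦ h _, fun h i ↦ (supp_subset_of_bhzLE (hc i _ (Fin.le_last i))).trans h⟩

theorem sum_powerset_neg_one_pow_ite_subset (J : Finset B) (L : Set B) :
    ∑ K ∈ J.powerset, (-1 : ℤ) ^ (J.card - K.card) * (if L ⊆ (K : Set B) then 1 else 0) =
      if L = (J : Set B) then 1 else 0 := by
  by_cases hL : L ⊆ J
  · have key := Finset.prod_add (fun _ : B ↦ (1 : ℤ)) (fun i ↦ if i ∈ L then 0 else -1) J
    have hleft : ∏ i ∈ J, ((1 : ℤ) + if i ∈ L then 0 else -1) =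
        if L = (J : Set B) then 1 else 0 := by
      have (i : B) : ((1 : ℤ) + if i ∈ L then 0 else -1) = if i ∈ L then 1 else 0 := by
        split_ifs <;> simp
      simp only [this]
      rw [Finset.prod_ite_zero]
      simp [Set.Subset.antisymm_iff, hL, Set.subset_def]
    rw [← hleft, key]
    refine Finset.sum_congr rfl fun K hK ↦ ?_
    rw [Finset.mem_powerset] at hK
    rw [Finset.prod_const_one, one_mul]
    by_cases hLK : L ⊆ K
    · rw [Finset.prod_congr rfl (g := fun _ ↦ (-1 : ℤ)), Finset.prod_const,
        Finset.card_sdiff_of_subset hK, if_pos hLK, mul_one]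
      intro i hi
      exact if_neg fun h ↦ (Finset.mem_sdiff.mp hi).2 (hLK h)
    · obtain ⟨i, hiL, hiK⟩ := Set.not_subset.mp hLK
      rw [if_neg hLK, mul_zero, Finset.prod_eq_zero (i := i)]
      · exact Finset.mem_sdiff.mpr ⟨hL hiL, hiK⟩
      · simp [hiL]
  · rw [if_neg fun h ↦ hL h.subset]
    refine Finset.sum_eq_zero fun K hK ↦ ?_
    rw [if_neg fun h ↦ hL (h.trans (Finset.coe_subset.mpr (Finset.mem_powerset.mp hK))),
      mul_zero]

/-- Inclusion–exclusion for BHZ chains: the number of `k`-chains (here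
`(k+1)`-chains, `k ≥ 0`) in the BHZ order with top support `J` equals
`Σ_{K ⊆ J} (−1)^{#J−#K}` times the number of such chains lying in `W_K`. -/
theorem bhz_chains_top_inclusion_exclusion [Finite W] [DecidableEq B]
    (k : ℕ) (J : Finset B) :
    (nchainsTop cs (bhzLE cs) k (J : Set B) : ℤ) =
      ∑ K ∈ J.powerset, (-1 : ℤ) ^ (J.card - K.card) *
        nchainsIn cs (bhzLE cs) k (K : Set B) := by
  have := Fintype.ofFinite W
  have hcard (P : Set B → Prop) : (Nat.card {c : Fin (k + 1) → W //
      (∀ i j : Fin (k + 1), i ≤ j → bhzLE cs (c i) (c j)) ∧ P (supp cs (c (Fin.last k)))} : ℤ) =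
      ∑ c : Fin (k + 1) → W with ∀ i j : Fin (k + 1), i ≤ j → bhzLE cs (c i) (c j),
        if P (supp cs (c (Fin.last k))) then 1 else 0 := by
    rw [Nat.card_eq_fintype_card, Fintype.card_subtype, Finset.sum_boole, Finset.filter_filter]
  simp only [nchainsIn_bhzLE_eq]
  rw [nchainsTop, hcard (· = (J : Set B))]
  simp only [fun K : Finset B ↦ hcard (· ⊆ (K : Set B)), Finset.mul_sum]
  rw [Finset.sum_comm]
  exact Finset.sum_congr rfl fun c _ ↦ (sum_powerset_neg_one_pow_ite_subset J _).symm

end ShardBHZ
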